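/- Let G be a powerful 2-group and let N be a normal subgroup of G with N ≤ G^4. Then N/N^4 is abelian. -/

import Mathlib

/-- For a subgroup `H` of `G`, the subgroup generated by `n`-th powers of elements of `H`. -/
def sgPow {G : Type*} [Group G] (H : Subgroup G) (n : ℕ) : Subgroup G :=
  Subgroup.closure {x | ∃ h ∈ H, h ^ n = x}

instance sgPow_top_normal {G : Type*} [Group G] (n : ℕ) :
    (sgPow (⊤ : Subgroup G) n).Normal := by
  constructor
  intro x hx g
  have key : ∀ y ∈ ({x | ∃ h ∈ (⊤ : Subgroup G), h ^ n = x} : Set G),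
      g * y * g⁻¹ ∈ sgPow (⊤ : Subgroup G) n := by
    rintro y ⟨h, -, rfl⟩
    have : g * h ^ n * g⁻¹ = (g * h * g⁻¹) ^ n := by simp [conj_pow]
    rw [this]
    exact Subgroup.subset_closure ⟨g * h * g⁻¹, trivial, rfl⟩
  induction hx using Subgroup.closure_induction with
  | mem y hy => exact key y hy
  | one => simpa using (sgPow (⊤ : Subgroup G) n).one_mem
  | mul y z hy hz ihy ihz =>
      have : g * (y * z) * g⁻¹ = (g * y * g⁻¹) * (g * z * g⁻¹) := by group
      rw [this]; exact Subgroup.mul_mem _ ihy ihz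
  | inv y hy ihy =>
      have : g * y⁻¹ * g⁻¹ = (g * y * g⁻¹)⁻¹ := by group
      rw [this]; exact Subgroup.inv_mem _ ihy

open scoped commutatorElement

universe u

lemma sgPow_normal {G : Type*} [Group G] (N : Subgroup G) [hN : N.Normal] (n : ℕ) :
    (sgPow N n).Normal := by
  refine ⟨fun x hx g => ?_⟩
  have h : sgPow N n ≤ (sgPow N n).comap (MulAut.conj g).toMonoidHom := by
    refine (Subgroup.closure_le _).2 ?_
    rintro _ ⟨y, hy, rfl⟩
    refine Subgroup.subset_closure ⟨g * y * g⁻¹, hN.conj_mem y hy g, ?_⟩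
    simp [conj_pow]
  exact h hx

lemma pow_mem_sgPow {G : Type*} [Group G] {H : Subgroup G} {x : G} (hx : x ∈ H) (n : ℕ) :
    x ^ n ∈ sgPow H n :=
  Subgroup.subset_closure ⟨x, hx, rfl⟩

lemma sgPow_le {G : Type*} [Group G] {H K : Subgroup G} {n : ℕ}
    (h : ∀ x ∈ H, x ^ n ∈ K) : sgPow H n ≤ K := by
  refine (Subgroup.closure_le _).2 ?_
  rintro _ ⟨y, hy, rfl⟩
  exact h y hy

lemma sgPow_le_self {G : Type*} [Group G] (H : Subgroup G) (n : ℕ) : sgPow H n ≤ H :=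
  sgPow_le fun _ hx => H.pow_mem hx n

lemma sgPow_mono {G : Type*} [Group G] {H K : Subgroup G} (h : H ≤ K) (n : ℕ) :
    sgPow H n ≤ sgPow K n :=
  sgPow_le fun _ hx => pow_mem_sgPow (h hx) n

lemma map_sgPow {G Q : Type*} [Group G] [Group Q] (φ : G →* Q) (H : Subgroup G) (n : ℕ) :
    (sgPow H n).map φ = sgPow (H.map φ) n := by
  apply le_antisymm
  · rw [Subgroup.map_le_iff_le_comap]
    refine sgPow_le fun x hx => ?_
    simpa using pow_mem_sgPow (Subgroup.mem_map_of_mem φ hx) n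
  · refine sgPow_le ?_
    rintro _ ⟨x, hx, rfl⟩
    exact ⟨x ^ n, pow_mem_sgPow hx n, by simp⟩

/-- If squares from `N` have central commutators of order at most two and vanishing fourth powers,
and `[N, G] ≤ N ^ 4`, then squares from `N` are central. -/
lemma commutator_sq_eq_one {Q : Type*} [Group Q] {N : Subgroup Q}
    (hN : ∀ y ∈ N, ∀ g, ⁅y, g⁆ ∈ sgPow N 4) (h4 : ∀ y ∈ N, (y ^ 2) ^ 4 = 1)
    (hc : ∀ y ∈ N, ∀ g, ⁅y ^ 2, g⁆ ∈ Subgroup.center Q)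
    (h2 : ∀ y ∈ N, ∀ g : Q, ⁅y ^ 2, g⁆ ^ 2 = 1) {y : Q} (hy : y ∈ N) (g : Q) : ⁅y ^ 2, g⁆ = 1 := by
  have key : ∀ u ∈ sgPow N 4, u ∈ Subgroup.center Q ∧ u ^ 2 = 1 := by
    intro u hu
    induction hu using Subgroup.closure_induction with
    | mem u hu =>
      obtain ⟨y, hy, rfl⟩ := hu
      refine ⟨Subgroup.mem_center_iff.2 fun g => ?_, ?_⟩
      · have h1 := Subgroup.mem_center_iff.1 (hc y hy g) (y ^ 2)
        have h3 : ⁅y ^ 4, g⁆ = 1 := by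
          rw [← h2 y hy g]
          have : ⁅y ^ 4, g⁆ = (y ^ 2 * ⁅y ^ 2, g⁆) * (y ^ 2)⁻¹ * ⁅y ^ 2, g⁆ := by
            simp only [commutatorElement_def]; group
          rw [this, h1, mul_inv_cancel_right, ← pow_two]
        exact (commutatorElement_eq_one_iff_mul_comm.1 h3).symm
      · rw [← h4 y hy]; group
    | one => exact ⟨Subgroup.one_mem _, one_pow 2⟩
    | mul a b _ _ ha hb =>
      refine ⟨Subgroup.mul_mem _ ha.1 hb.1, ?_⟩
      have : Commute a b := (Subgroup.mem_center_iff.1 hb.1 a)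
      rw [this.mul_pow, ha.2, hb.2, one_mul]
    | inv a _ ha => exact ⟨Subgroup.inv_mem _ ha.1, by rw [inv_pow, ha.2, inv_one]⟩
  obtain ⟨hu, hu2⟩ := key _ (hN y hy g)
  have h1 := Subgroup.mem_center_iff.1 hu y
  have : ⁅y ^ 2, g⁆ = (y * ⁅y, g⁆) * y⁻¹ * ⁅y, g⁆ := by
    simp only [commutatorElement_def, pow_two]; group
  rw [this, h1, mul_inv_cancel_right, ← pow_two, hu2]

/-- For a normal subgroup `X` of a finite `2`-group, `X ≤ W [X, G] X ^ 2` implies `X ≤ W`. -/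
lemma le_of_le_sup_commutator_sup_sgPow {G : Type*} [Group G] [Finite G] (hG : IsPGroup 2 G)
    (X W : Subgroup G) [hX : X.Normal] [hW : W.Normal]
    (h : X ≤ W ⊔ ⁅X, (⊤ : Subgroup G)⁆ ⊔ sgPow X 2) : X ≤ W := by
  have hK : X ≤ W ⊔ ⁅X, (⊤ : Subgroup G)⁆ := by
    set K := W ⊔ ⁅X, (⊤ : Subgroup G)⁆
    have hcomm : ∀ x ∈ X, ∀ y : G, Commute (QuotientGroup.mk' K x) (QuotientGroup.mk' K y) := by
      intro x hx y
      have : ⁅x, y⁆ ∈ K :=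
        Subgroup.mem_sup_right (Subgroup.commutator_mem_commutator hx (Subgroup.mem_top _))
      rw [← commutatorElement_eq_one_iff_commute, ← map_commutatorElement]
      exact (QuotientGroup.eq_one_iff _).2 this
    have hsq : ∀ x ∈ X, ∃ y ∈ X, QuotientGroup.mk' K x = QuotientGroup.mk' K y ^ 2 := by
      intro x hx
      obtain ⟨k, hk, s, hs, rfl⟩ := Subgroup.mem_sup_of_normal_left.1 (h hx)
      have hk1 : QuotientGroup.mk' K k = 1 := (QuotientGroup.eq_one_iff _).2 hk
      rw [map_mul, hk1, one_mul]
      clear hx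
      induction hs using Subgroup.closure_induction with
      | mem u hu => obtain ⟨y, hy, rfl⟩ := hu; exact ⟨y, hy, map_pow _ _ _⟩
      | one => exact ⟨1, X.one_mem, by simp⟩
      | mul a b _ _ ha hb =>
        obtain ⟨y, hy, h1⟩ := ha
        obtain ⟨z, hz, h2⟩ := hb
        exact ⟨y * z, X.mul_mem hy hz, by rw [map_mul, h1, h2, map_mul, (hcomm y hy z).mul_pow]⟩
      | inv a _ ha =>
        obtain ⟨y, hy, h1⟩ := ha
        exact ⟨y⁻¹, X.inv_mem hy, by rw [map_inv, h1, map_inv, inv_pow]⟩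
    have hpow : ∀ n, ∀ x ∈ X, ∃ y ∈ X, QuotientGroup.mk' K x = QuotientGroup.mk' K y ^ 2 ^ n := by
      intro n
      induction n with
      | zero => exact fun x hx => ⟨x, hx, by simp⟩
      | succ n ih =>
        intro x hx
        obtain ⟨y, hy, h1⟩ := ih x hx
        obtain ⟨z, hz, h2⟩ := hsq y hy
        exact ⟨z, hz, by rw [h1, h2, ← pow_mul, pow_succ']⟩
    obtain ⟨n, hn⟩ := IsPGroup.iff_card.1 hG
    intro x hx
    obtain ⟨y, -, hy⟩ := hpow n x hx
    rw [← map_pow, ← hn, pow_card_eq_one', map_one] at hy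
    exact (QuotientGroup.eq_one_iff _).1 hy
  have hnil : Group.IsNilpotent G := hG.isNilpotent
  obtain ⟨n, hn⟩ := Subgroup.nilpotent_iff_lowerCentralSeries.1 hnil
  have hstep : ∀ n, X ≤ W ⊔ (⊤ : Subgroup G).lowerCentralSeries n := by
    intro n
    induction n with
    | zero => simp
    | succ n ih =>
      refine hK.trans (sup_le le_sup_left ?_)
      refine Subgroup.commutator_le.2 fun x hx g _ => ?_
      obtain ⟨w, hw, u, hu, rfl⟩ := Subgroup.mem_sup_of_normal_left.1 (ih hx)
      have h1 : ⁅w * u, g⁆ = w * ⁅u, g⁆ * (g * w⁻¹ * g⁻¹) := by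
        simp only [commutatorElement_def]; group
      rw [h1]
      refine Subgroup.mul_mem _ (Subgroup.mul_mem _ (Subgroup.mem_sup_left hw)
        (Subgroup.mem_sup_right ?_))
        (Subgroup.mem_sup_left (hW.conj_mem _ (W.inv_mem hw) g))
      rw [Subgroup.lowerCentralSeries_succ]
      exact Subgroup.commutator_mem_commutator hu (Subgroup.mem_top _)
  simpa [hn] using hstep n

lemma commutator_sgPow_two_le {G : Type*} [Group G] [Finite G] (hG : IsPGroup 2 G)
    (N : Subgroup G) [hN : N.Normal] (h : ⁅N, (⊤ : Subgroup G)⁆ ≤ sgPow N 4) :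
    ⁅sgPow N 2, (⊤ : Subgroup G)⁆ ≤ sgPow (sgPow N 2) 4 := by
  have := sgPow_normal N 2
  have := sgPow_normal (sgPow N 2) 4
  have := sgPow_normal ⁅sgPow N 2, (⊤ : Subgroup G)⁆ 2
  refine le_of_le_sup_commutator_sup_sgPow hG _ _ ?_
  set X := ⁅sgPow N 2, (⊤ : Subgroup G)⁆
  set K := sgPow (sgPow N 2) 4 ⊔ ⁅X, (⊤ : Subgroup G)⁆ ⊔ sgPow X 2
  have hKn : K.Normal := inferInstance
  let φ := QuotientGroup.mk' K
  have hφ : ∀ {x}, x ∈ K → φ x = 1 := fun {x} hx => (QuotientGroup.eq_one_iff x).2 hx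
  have hφs : Function.Surjective φ := QuotientGroup.mk'_surjective K
  have hXm : ∀ y ∈ N, ∀ g : G, ⁅y ^ 2, g⁆ ∈ X := fun y hy g =>
    Subgroup.commutator_mem_commutator (pow_mem_sgPow hy 2) (Subgroup.mem_top g)
  have key : ∀ y ∈ N.map φ, ∀ g : G ⧸ K, ⁅y ^ 2, g⁆ = 1 := by
    intro y hy g
    refine commutator_sq_eq_one (N := N.map φ) ?_ ?_ ?_ ?_ hy g
    · rintro _ ⟨y, hy, rfl⟩ g
      obtain ⟨g, rfl⟩ := hφs g
      rw [← map_sgPow, ← map_commutatorElement]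
      exact Subgroup.mem_map_of_mem _
        (h (Subgroup.commutator_mem_commutator hy (Subgroup.mem_top g)))
    · rintro _ ⟨y, hy, rfl⟩
      rw [← map_pow, ← map_pow]
      exact hφ (Subgroup.mem_sup_left (Subgroup.mem_sup_left
        (pow_mem_sgPow (pow_mem_sgPow hy 2) 4)))
    · rintro _ ⟨y, hy, rfl⟩ g
      obtain ⟨g, rfl⟩ := hφs g
      refine Subgroup.mem_center_iff.2 fun z => ?_
      obtain ⟨z, rfl⟩ := hφs z
      rw [← map_pow, ← map_commutatorElement]
      refine (commutatorElement_eq_one_iff_mul_comm.1 ?_).symm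
      rw [← map_commutatorElement]
      exact hφ (Subgroup.mem_sup_left (Subgroup.mem_sup_right
        (Subgroup.commutator_mem_commutator (hXm y hy g) (Subgroup.mem_top z))))
    · rintro _ ⟨y, hy, rfl⟩ g
      obtain ⟨g, rfl⟩ := hφs g
      rw [← map_pow, ← map_commutatorElement, ← map_pow]
      exact hφ (Subgroup.mem_sup_right (pow_mem_sgPow (hXm y hy g) 2))
  have hc : sgPow N 2 ≤ (Subgroup.center (G ⧸ K)).comap φ := by
    refine sgPow_le fun y hy => Subgroup.mem_center_iff.2 fun g => ?_
    have := key (φ y) (Subgroup.mem_map_of_mem _ hy) g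
    rw [← map_pow] at this
    exact (commutatorElement_eq_one_iff_mul_comm.1 this).symm
  refine Subgroup.commutator_le.2 fun x hx g _ => (QuotientGroup.eq_one_iff (N := K) _).1 ?_
  change φ ⁅x, g⁆ = 1
  rw [map_commutatorElement, commutatorElement_eq_one_iff_mul_comm]
  exact (Subgroup.mem_center_iff.1 (hc hx) (φ g)).symm

/-- The descending series of iterated agemo subgroups `P 0 = G`, `P (i + 1) = (P i) ^ 2`. -/
def powSeries (G : Type*) [Group G] : ℕ → Subgroup G
  | 0 => ⊤
  | i + 1 => sgPow (powSeries G i) 2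

/-- The commutator condition defining powerful `2`-groups. -/
def IsPowerfulTwo (G : Type*) [Group G] : Prop :=
  ⁅(⊤ : Subgroup G), (⊤ : Subgroup G)⁆ ≤ sgPow ⊤ 4

instance powSeries_normal (G : Type*) [Group G] : ∀ i, (powSeries G i).Normal
  | 0 => inferInstanceAs (⊤ : Subgroup G).Normal
  | i + 1 => by
    have := powSeries_normal G i
    exact sgPow_normal _ _

lemma powSeries_succ_le (G : Type*) [Group G] (i : ℕ) : powSeries G (i + 1) ≤ powSeries G i :=
  sgPow_le_self _ _

lemma powSeries_antitone (G : Type*) [Group G] : Antitone (powSeries G) :=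
  antitone_nat_of_succ_le (powSeries_succ_le G)

lemma pow_mem_powSeries {G : Type*} [Group G] {i : ℕ} {x : G} (hx : x ∈ powSeries G i) (j : ℕ) :
    x ^ 2 ^ j ∈ powSeries G (i + j) := by
  induction j with
  | zero => simpa using hx
  | succ j ih =>
    rw [pow_succ, pow_mul]
    exact pow_mem_sgPow ih 2

lemma pow_two_pow_mem_powSeries {G : Type*} [Group G] (x : G) (j : ℕ) :
    x ^ 2 ^ j ∈ powSeries G j := by
  simpa using pow_mem_powSeries (i := 0) (Subgroup.mem_top x) j

lemma sgPow_four_le {G : Type*} [Group G] (H : Subgroup G) :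
    sgPow H 4 ≤ sgPow (sgPow H 2) 2 :=
  sgPow_le fun x hx => by
    rw [show x ^ 4 = (x ^ 2) ^ 2 by rw [← pow_mul]]
    exact pow_mem_sgPow (pow_mem_sgPow hx 2) 2

lemma commutator_powSeries_le_sgPow {G : Type*} [Group G] [Finite G] (hG : IsPGroup 2 G)
    (hp : IsPowerfulTwo G) (i : ℕ) :
    ⁅powSeries G i, (⊤ : Subgroup G)⁆ ≤ sgPow (powSeries G i) 4 := by
  induction i with
  | zero => exact hp
  | succ i ih => exact commutator_sgPow_two_le hG _ ih

lemma commutator_powSeries_le {G : Type*} [Group G] [Finite G] (hG : IsPGroup 2 G)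
    (hp : IsPowerfulTwo G) (i : ℕ) :
    ⁅powSeries G i, (⊤ : Subgroup G)⁆ ≤ powSeries G (i + 2) :=
  (commutator_powSeries_le_sgPow hG hp i).trans (sgPow_four_le _)

lemma commutatorElement_mem_powSeries {G : Type*} [Group G] [Finite G] (hG : IsPGroup 2 G)
    (hp : IsPowerfulTwo G) {i : ℕ} {x : G} (hx : x ∈ powSeries G i) (g : G) :
    ⁅x, g⁆ ∈ powSeries G (i + 2) :=
  commutator_powSeries_le hG hp i (Subgroup.commutator_mem_commutator hx (Subgroup.mem_top g))

lemma commutatorElement_mem_powSeries' {G : Type*} [Group G] [Finite G] (hG : IsPGroup 2 G)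
    (hp : IsPowerfulTwo G) {i : ℕ} {x : G} (hx : x ∈ powSeries G i) (g : G) :
    ⁅g, x⁆ ∈ powSeries G (i + 2) := by
  rw [← commutatorElement_inv]
  exact inv_mem (commutatorElement_mem_powSeries hG hp hx g)

lemma isPowerfulTwo_subgroup_iff {G : Type*} [Group G] (H : Subgroup G) :
    IsPowerfulTwo H ↔ ⁅H, H⁆ ≤ sgPow H 4 := by
  rw [IsPowerfulTwo, ← Subgroup.map_subtype_le_map_subtype, Subgroup.map_commutator, map_sgPow,
    ← MonoidHom.range_eq_map, Subgroup.range_subtype]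

lemma IsPowerfulTwo.quotient {G : Type*} [Group G] (hp : IsPowerfulTwo G) (N : Subgroup G)
    [N.Normal] : IsPowerfulTwo (G ⧸ N) := by
  have h := Subgroup.map_mono (f := QuotientGroup.mk' N) hp
  rwa [Subgroup.map_commutator, map_sgPow,
    Subgroup.map_top_of_surjective _ (QuotientGroup.mk'_surjective N)] at h

lemma exists_powSeries_eq_bot {G : Type*} [Group G] [Finite G] (hG : IsPGroup 2 G) :
    ∃ n, powSeries G n = ⊥ := by
  obtain ⟨n, hn⟩ := wellFoundedGT_iff_monotone_chain_condition.1 inferInstance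
    (⟨fun i => OrderDual.toDual (powSeries G i), powSeries_antitone G⟩ :
      ℕ →o (Subgroup G)ᵒᵈ)
  refine ⟨n, ?_⟩
  have h : powSeries G n = powSeries G (n + 1) := hn (n + 1) n.le_succ
  exact le_bot_iff.1 (le_of_le_sup_commutator_sup_sgPow hG _ ⊥ (h.le.trans le_sup_right))

lemma mul_comm_of_zpowers_sup_eq_top {G : Type*} [Group G] [Finite G] (hG : IsPGroup 2 G)
    (hp : IsPowerfulTwo G) {b : G} (hb : Subgroup.zpowers b ⊔ powSeries G 1 = ⊤) (x y : G) :
    x * y = y * x := by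
  have h : ∀ i, Subgroup.zpowers b ⊔ powSeries G (i + 1) = ⊤ := by
    intro i
    induction i with
    | zero => exact hb
    | succ i ih =>
      refine top_le_iff.1 (ih.ge.trans (sup_le le_sup_left ?_))
      refine sgPow_le fun x _ => ?_
      obtain ⟨_, ⟨j, rfl⟩, y, hy, rfl⟩ :=
        Subgroup.mem_sup_of_normal_right.1 (ih.ge (Subgroup.mem_top x))
      have h1 : (b ^ j * y) ^ 2 = b ^ j * b ^ j * (⁅(b ^ j)⁻¹, y⁆ * y ^ 2) := by
        simp only [commutatorElement_def, pow_two]; group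
      have hbj : b ^ j ∈ Subgroup.zpowers b := ⟨j, rfl⟩
      change (b ^ j * y) ^ 2 ∈ _
      rw [h1]
      refine Subgroup.mul_mem_sup (mul_mem hbj hbj) (mul_mem ?_ (pow_mem_sgPow hy 2))
      exact powSeries_succ_le G _ (commutatorElement_mem_powSeries' hG hp hy _)
  obtain ⟨n, hn⟩ := exists_powSeries_eq_bot hG
  have hz : Subgroup.zpowers b = ⊤ := by
    have := h n
    rwa [le_bot_iff.1 ((powSeries_succ_le G n).trans hn.le), sup_bot_eq] at this
  obtain ⟨i, rfl⟩ := hz.ge (Subgroup.mem_top x)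
  obtain ⟨j, rfl⟩ := hz.ge (Subgroup.mem_top y)
  exact (Commute.refl b).zpow_zpow i j

lemma isPowerfulTwo_zpowers_sup {G : Type*} [Group G] [Finite G] (hG : IsPGroup 2 G)
    (hp : IsPowerfulTwo G) (b : G) :
    IsPowerfulTwo ↥(Subgroup.zpowers b ⊔ powSeries G 1) := by
  rw [isPowerfulTwo_subgroup_iff]
  refine le_trans ?_ (sgPow_mono le_sup_right 4)
  refine le_trans ?_ (commutator_powSeries_le_sgPow hG hp 1)
  refine Subgroup.commutator_le.2 fun x hx y hy => ?_
  obtain ⟨_, ⟨i, rfl⟩, u, hu, rfl⟩ := Subgroup.mem_sup_of_normal_right.1 hx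
  obtain ⟨_, ⟨j, rfl⟩, v, hv, rfl⟩ := Subgroup.mem_sup_of_normal_right.1 hy
  set C := ⁅powSeries G 1, (⊤ : Subgroup G)⁆
  have hc : ∀ {u}, u ∈ powSeries G 1 → ∀ g : G,
      Commute (QuotientGroup.mk' C u) (QuotientGroup.mk' C g) := by
    intro u hu g
    rw [← commutatorElement_eq_one_iff_commute, ← map_commutatorElement]
    exact (QuotientGroup.eq_one_iff _).2
      (Subgroup.commutator_mem_commutator hu (Subgroup.mem_top g))
  rw [← QuotientGroup.eq_one_iff (N := C)]
  change QuotientGroup.mk' C ⁅b ^ i * u, b ^ j * v⁆ = 1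
  rw [map_commutatorElement, commutatorElement_eq_one_iff_commute,
    map_mul (f := QuotientGroup.mk' C) (x := b ^ i)]
  refine Commute.mul_left ?_ (hc hu _)
  rw [map_mul]
  refine Commute.mul_right ?_ (hc hv _).symm
  rw [map_zpow, map_zpow]
  exact (Commute.refl _).zpow_zpow i j

lemma mem_sgPow_iff_exists_mem_top {G : Type*} [Group G] {H : Subgroup G} {n : ℕ} {x : G} :
    x ∈ sgPow H n ↔ ∃ y ∈ sgPow (⊤ : Subgroup H) n, (y : G) = x := by
  have h := map_sgPow H.subtype ⊤ n
  rw [← MonoidHom.range_eq_map, Subgroup.range_subtype] at h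
  rw [← h]
  rfl

lemma exists_map_eq_sq {G Q : Type*} [Group G] [Group Q] (φ : G →* Q)
    (hφ : ∀ x y, Commute (φ x) (φ y)) {g : G} (hg : g ∈ powSeries G 1) :
    ∃ x, φ g = φ x ^ 2 := by
  change g ∈ sgPow _ 2 at hg
  induction hg using Subgroup.closure_induction with
  | mem u hu => obtain ⟨y, -, rfl⟩ := hu; exact ⟨y, map_pow _ _ _⟩
  | one => exact ⟨1, by simp⟩
  | mul a b _ _ ha hb =>
    obtain ⟨y, h1⟩ := ha
    obtain ⟨z, h2⟩ := hb
    exact ⟨y * z, by rw [map_mul, h1, h2, map_mul, (hφ y z).mul_pow]⟩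
  | inv a _ ha =>
    obtain ⟨y, h1⟩ := ha
    exact ⟨y⁻¹, by rw [map_inv, h1, map_inv, inv_pow]⟩

lemma exists_sq_eq_of_mem_powSeries_one (n : ℕ) : ∀ (G : Type u) [Group G] [Finite G],
    Nat.card G = n → IsPGroup 2 G → IsPowerfulTwo G → ∀ g ∈ powSeries G 1, ∃ x, x ^ 2 = g := by
  induction n using Nat.strong_induction_on with
  | _ n ih =>
  intro G _ _ hn hG hp g hg
  obtain ⟨x, hx⟩ := exists_map_eq_sq (QuotientGroup.mk' (powSeries G 2)) (fun x y => by
    rw [← commutatorElement_eq_one_iff_commute, ← map_commutatorElement]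
    exact (QuotientGroup.eq_one_iff _).2
      (commutatorElement_mem_powSeries (i := 0) hG hp (Subgroup.mem_top x) y)) hg
  have hy : (x ^ 2)⁻¹ * g ∈ powSeries G 2 := by
    rw [← map_pow] at hx
    exact QuotientGroup.eq.1 hx.symm
  set H := Subgroup.zpowers x ⊔ powSeries G 1
  by_cases hT : H = ⊤
  · obtain ⟨y, hy⟩ := exists_map_eq_sq (MonoidHom.id G)
      (mul_comm_of_zpowers_sup_eq_top hG hp hT) hg
    exact ⟨y, hy.symm⟩
  · have hgH : g ∈ sgPow H 2 := by
      rw [← mul_inv_cancel_left (x ^ 2) g]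
      exact mul_mem (pow_mem_sgPow (Subgroup.mem_sup_left (Subgroup.mem_zpowers x)) 2)
        (sgPow_mono le_sup_right 2 hy)
    obtain ⟨y, hy', rfl⟩ := mem_sgPow_iff_exists_mem_top.1 hgH
    obtain ⟨z, rfl⟩ := ih (Nat.card H) (hn ▸ lt_of_le_of_ne (Subgroup.card_le_card_group H)
      fun h => hT (Subgroup.eq_top_of_card_eq H h)) H rfl (hG.to_subgroup H)
      (isPowerfulTwo_zpowers_sup hG hp x) y hy'
    exact ⟨z, rfl⟩

lemma exists_sq_eq_of_mem_powSeries_succ {G : Type*} [Group G] [Finite G] (hG : IsPGroup 2 G)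
    (hp : IsPowerfulTwo G) {i : ℕ} {x : G} (hx : x ∈ powSeries G (i + 1)) :
    ∃ w ∈ powSeries G i, w ^ 2 = x := by
  obtain ⟨y, hy, rfl⟩ := mem_sgPow_iff_exists_mem_top.1 hx
  obtain ⟨z, rfl⟩ := exists_sq_eq_of_mem_powSeries_one _ (powSeries G i) rfl (hG.to_subgroup _)
    ((isPowerfulTwo_subgroup_iff _).2 ((Subgroup.commutator_mono le_rfl le_top).trans
      (commutator_powSeries_le_sgPow hG hp i))) y hy
  exact ⟨z, z.2, rfl⟩

lemma exists_pow_eq_of_mem_powSeries {G : Type*} [Group G] [Finite G] (hG : IsPGroup 2 G)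
    (hp : IsPowerfulTwo G) {i : ℕ} : ∀ {x : G}, x ∈ powSeries G i → ∃ w, w ^ 2 ^ i = x := by
  induction i with
  | zero => exact fun {x} _ => ⟨x, by simp⟩
  | succ i ih =>
    intro x hx
    obtain ⟨w, hw, rfl⟩ := exists_sq_eq_of_mem_powSeries_succ hG hp hx
    obtain ⟨v, rfl⟩ := ih hw
    exact ⟨v, by rw [pow_succ, pow_mul]⟩

/-- Commutators of `2 ^ m`-th powers of elements of order dividing `2 ^ (N + 1)` with elements of
order dividing `2 ^ N` have order dividing `2 ^ (N - m)`. -/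
def CommutatorPowBound (G : Type*) [Group G] (N : ℕ) : Prop :=
  ∀ s x : G, s ^ 2 ^ (N + 1) = 1 → x ^ 2 ^ N = 1 →
    ∀ m ≤ N, ⁅x, s ^ 2 ^ m⁆ ^ 2 ^ (N - m) = 1

/-- Commutators have order at most that of their first entry, for `2`-power exponents. -/
def CommutatorOrderBound (G : Type*) [Group G] : Prop :=
  ∀ (i : ℕ) (b g : G), b ^ 2 ^ i = 1 → ⁅b, g⁆ ^ 2 ^ i = 1

lemma pow_two_pow_eq_one_of_le {G : Type*} [Group G] {x : G} {i j : ℕ} (h : x ^ 2 ^ i = 1)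
    (hij : i ≤ j) : x ^ 2 ^ j = 1 := by
  obtain ⟨k, rfl⟩ := Nat.exists_eq_add_of_le hij
  rw [pow_add, pow_mul, h, one_pow]

lemma sq_pow_two_pow {G : Type*} [Group G] (x : G) (n : ℕ) :
    (x ^ 2) ^ 2 ^ n = x ^ 2 ^ (n + 1) := by
  rw [← pow_mul, pow_succ']

lemma conj_pow_eq_one {G : Type*} [Group G] {x : G} {n : ℕ} (h : x ^ n = 1) (g : G) :
    (g * x * g⁻¹) ^ n = 1 := by
  rw [conj_pow, h, mul_one, mul_inv_cancel]

lemma commutatorElement_sq_right {G : Type*} [Group G] (x y : G) :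
    ⁅x, y ^ 2⁆ = ⁅x, y⁆ * (⁅y, ⁅x, y⁆⁆ * ⁅x, y⁆ ^ 2) * ⁅x, y⁆⁻¹ := by
  simp only [commutatorElement_def, pow_two]; group

lemma mul_pow_two_pow_eq {G : Type*} [Group G] [Finite G] (hG : IsPGroup 2 G)
    (hp : IsPowerfulTwo G) {N : ℕ} (hS : ∀ M, N < M → CommutatorPowBound G M) (n : ℕ) :
    ∀ {L l : ℕ} {e x : G}, L + 1 = l + n → N < L → e ∈ powSeries G l → e ^ 2 ^ n = 1 →
      x ^ 2 ^ L = 1 → (e * x) ^ 2 ^ n = x ^ 2 ^ n := by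
  induction n with
  | zero =>
    intro L l e x _ _ _ he _
    rw [show e = 1 by simpa using he, one_mul]
  | succ n ih =>
    intro L l e x hL hN hel he hx
    have hf : ⁅x, e⁆ ^ 2 ^ n = 1 := by
      obtain ⟨s, rfl⟩ := exists_pow_eq_of_mem_powSeries hG hp hel
      have := hS L hN s x (by rwa [hL, pow_add, pow_mul]) hx l (by omega)
      rwa [show L - l = n by omega] at this
    have h1 : (⁅x, e⁆ * e ^ 2) ^ 2 ^ n = 1 := by
      rw [ih (L := L + 1) (l := l + 2) (by omega) (by omega)
        (commutatorElement_mem_powSeries' hG hp hel x) hf, sq_pow_two_pow, he]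
      rw [sq_pow_two_pow]
      exact pow_two_pow_eq_one_of_le he (by omega)
    have h2 : (e * x) ^ 2 = e * (⁅x, e⁆ * e ^ 2) * e⁻¹ * x ^ 2 := by
      simp only [commutatorElement_def, pow_two]; group
    rw [← sq_pow_two_pow, h2, ← sq_pow_two_pow]
    refine ih (L := L) (l := l + 1) (by omega) hN ?_ (conj_pow_eq_one h1 e) ?_
    · refine (powSeries_normal G _).conj_mem _ (mul_mem ?_ (pow_mem_sgPow hel 2)) e
      exact powSeries_succ_le G _ (commutatorElement_mem_powSeries' hG hp hel x)
    · rw [sq_pow_two_pow]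
      exact pow_two_pow_eq_one_of_le hx (by omega)

lemma CommutatorOrderBound.commutatorPowBound {G : Type*} [Group G] [Finite G] (hG : IsPGroup 2 G)
    (hp : IsPowerfulTwo G) (hA : CommutatorOrderBound G) (N : ℕ) : CommutatorPowBound G N := by
  obtain ⟨c, hc⟩ := IsPGroup.iff_card.1 hG
  have hexp : ∀ g : G, g ^ 2 ^ c = 1 := fun g => by rw [← hc, pow_card_eq_one']
  suffices h : ∀ d N, 2 * c ≤ N + d → CommutatorPowBound G N from h (2 * c) N (by omega)
  intro d
  induction d with
  | zero =>
    intro N hN s x _ _ m _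
    rcases le_total c m with h | h
    · rw [pow_two_pow_eq_one_of_le (hexp s) h, commutatorElement_one_right, one_pow]
    · exact pow_two_pow_eq_one_of_le (hexp _) (by omega)
  | succ d ih =>
    intro N hN s x hs hx m
    have hS : ∀ M, N < M → CommutatorPowBound G M := fun M hM => ih M (by omega)
    induction m with
    | zero =>
      intro _
      simpa using hA N x s hx
    | succ m ihm =>
      intro hm
      specialize ihm (by omega)
      obtain ⟨n, rfl⟩ : ∃ n, N = m + 1 + n := ⟨N - m - 1, by omega⟩
      rw [show m + 1 + n - m = n + 1 by omega] at ihm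
      rw [show m + 1 + n - (m + 1) = n by omega]
      rw [pow_succ 2 m, pow_mul, commutatorElement_sq_right]
      apply conj_pow_eq_one
      have hmem : ⁅x, s ^ 2 ^ m⁆ ∈ powSeries G (m + 2) :=
        commutatorElement_mem_powSeries' hG hp (pow_two_pow_mem_powSeries s m) x
      have hf : ⁅s ^ 2 ^ m, ⁅x, s ^ 2 ^ m⁆⁆ ^ 2 ^ n = 1 := by
        obtain ⟨r, hr⟩ := exists_pow_eq_of_mem_powSeries hG hp hmem
        have := hS (m + n + 2) (by omega) r (s ^ 2 ^ m) ?_ ?_ (m + 2) (by omega)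
        · rwa [hr, show m + n + 2 - (m + 2) = n by omega] at this
        · rw [show m + n + 2 + 1 = m + 2 + (n + 1) by omega, pow_add, pow_mul, hr, ihm]
        · rw [← pow_mul, ← pow_add]
          exact pow_two_pow_eq_one_of_le hs (by omega)
      rw [mul_pow_two_pow_eq hG hp hS n (L := m + n + 3) (l := m + 4) (by omega) (by omega)
        (commutatorElement_mem_powSeries' hG hp hmem _) hf, sq_pow_two_pow, ihm]
      rw [sq_pow_two_pow]
      exact pow_two_pow_eq_one_of_le ihm (by omega)

lemma exists_central_orderOf_two {G : Type*} [Group G] [Finite G] [Nontrivial G]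
    (hG : IsPGroup 2 G) : ∃ z ∈ Subgroup.center G, orderOf z = 2 := by
  have := hG.center_nontrivial
  have hd : 2 ∣ Nat.card (Subgroup.center G) := by
    refine (hG.to_subgroup (Subgroup.center G)).card_eq_or_dvd.resolve_left fun h => ?_
    rw [Nat.card_eq_one_iff_unique] at h
    exact not_subsingleton _ h.1
  obtain ⟨z, hz⟩ := exists_prime_orderOf_dvd_card' 2 hd
  exact ⟨z, z.2, by rwa [Subgroup.orderOf_coe]⟩

lemma commutatorElement_sq_left {G : Type*} [Group G] (b g : G) :
    ⁅b ^ 2, g⁆ = ⁅b, ⁅b, g⁆⁆ * ⁅b, g⁆ ^ 2 := by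
  simp only [commutatorElement_def, pow_two]; group

lemma mem_powSeries_two_commutatorElement {G : Type*} [Group G] [Finite G] (hG : IsPGroup 2 G)
    (hp : IsPowerfulTwo G) (x y : G) : ⁅x, y⁆ ∈ powSeries G 2 :=
  commutatorElement_mem_powSeries (i := 0) hG hp (Subgroup.mem_top x) y

lemma commutatorOrderBound_of_card_eq (n : ℕ) : ∀ (G : Type u) [Group G] [Finite G],
    Nat.card G = n → IsPGroup 2 G → IsPowerfulTwo G → CommutatorOrderBound G := by
  induction n using Nat.strong_induction_on with
  | _ n ih =>
  intro G _ _ hn hG hp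
  by_cases hcomm : ∀ x y : G, x * y = y * x
  · intro i b g _
    rw [commutatorElement_eq_one_iff_mul_comm.2 (hcomm b g), one_pow]
  let H : G → Subgroup G := fun x => Subgroup.zpowers x ⊔ powSeries G 1
  have hHG : ∀ x, IsPGroup 2 (H x) := fun x => hG.to_subgroup _
  have hHp : ∀ x, IsPowerfulTwo (H x) := fun x => isPowerfulTwo_zpowers_sup hG hp x
  have hHA : ∀ x, CommutatorOrderBound (H x) := fun x =>
    ih _ (hn ▸ lt_of_le_of_ne (Subgroup.card_le_card_group _) fun h => hcomm
      (mul_comm_of_zpowers_sup_eq_top hG hp (Subgroup.eq_top_of_card_eq _ h))) _ rfl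
      (hHG x) (hHp x)
  have hHS : ∀ x N, CommutatorPowBound (H x) N := fun x N =>
    (hHA x).commutatorPowBound (hHG x) (hHp x) N
  have hmem : ∀ x, x ∈ H x := fun x => Subgroup.mem_sup_left (Subgroup.mem_zpowers x)
  have hle : ∀ x {y j}, y ∈ powSeries G (j + 1) → y ∈ H x := fun x y j hy =>
    Subgroup.mem_sup_right (powSeries_antitone G (by omega) hy)
  have : Nontrivial G := by
    by_contra h
    rw [not_nontrivial_iff_subsingleton] at h
    exact hcomm fun x y => Subsingleton.elim _ _
  obtain ⟨z, hzc, hz⟩ := exists_central_orderOf_two hG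
  have hZc : Subgroup.zpowers z ≤ Subgroup.center G := by simpa using hzc
  have : (Subgroup.zpowers z).Normal := ⟨fun x hx g => by
    rwa [Subgroup.mem_center_iff.1 (hZc hx) g, mul_inv_cancel_right]⟩
  have hQ : CommutatorOrderBound (G ⧸ Subgroup.zpowers z) := by
    refine ih _ ?_ _ rfl (hG.to_quotient _) (hp.quotient _)
    have h := Subgroup.card_eq_card_quotient_mul_card_subgroup (Subgroup.zpowers z)
    rw [Nat.card_zpowers, hz, hn] at h
    have : 0 < n := hn ▸ Nat.card_pos
    omega
  intro i
  induction i with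
  | zero =>
    intro b g hb
    rw [show b = 1 by simpa using hb, commutatorElement_one_left, one_pow]
  | succ i ihi =>
    intro b g hb
    have hh : ⁅b, g⁆ ^ 2 ^ (i + 2) = 1 := by
      have h1 := hQ (i + 1) (QuotientGroup.mk' _ b) (QuotientGroup.mk' _ g)
        (by rw [← map_pow, hb, map_one])
      rw [← map_commutatorElement, ← map_pow] at h1
      obtain ⟨j, hj⟩ := (QuotientGroup.eq_one_iff _).1 h1
      have h2 : (z ^ j) ^ 2 = 1 := by
        rw [← zpow_natCast, ← zpow_mul, mul_comm, zpow_mul, zpow_natCast, ← hz, pow_orderOf_eq_one,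
          one_zpow]
      rw [pow_succ, pow_mul, ← hj]
      exact h2
    have hb2 : (⁅b, ⁅b, g⁆⁆ * ⁅b, g⁆ ^ 2) ^ 2 ^ i = 1 := by
      rw [← commutatorElement_sq_left]
      exact ihi (b ^ 2) g (by rwa [sq_pow_two_pow])
    obtain ⟨k, hk, hkh⟩ := exists_sq_eq_of_mem_powSeries_succ hG hp
      (mem_powSeries_two_commutatorElement hG hp b g)
    have hk1 : k ^ 2 ^ (i + 3) = 1 := by rw [← sq_pow_two_pow, hkh, hh]
    let b' : H b := ⟨b, hmem b⟩
    let k' : H b := ⟨k, hle b (j := 0) hk⟩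
    have hq : ⁅b', k'⁆ ^ 2 ^ (i + 1) = 1 := hHA b _ b' k' (Subtype.ext hb)
    have hqG : ⁅b, k⁆ ^ 2 ^ (i + 1) = 1 := congrArg Subtype.val hq
    have hpw : ⁅k, ⁅b, k⁆⁆ ^ 2 ^ i = 1 := by
      obtain ⟨t, ht⟩ := exists_pow_eq_of_mem_powSeries hG hp
        (commutatorElement_mem_powSeries' hG hp hk b)
      have ht1 : t ^ 2 ^ (i + 3 + 1) = 1 := by
        rw [show i + 3 + 1 = 1 + 2 + (i + 1) by omega, pow_add, pow_mul, ht, hqG]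
      have := hHS t (i + 3) ⟨t, hmem t⟩ ⟨k, hle t (j := 0) hk⟩ (Subtype.ext ht1)
        (Subtype.ext hk1) 3 (by omega)
      have := congrArg Subtype.val this
      rw [← ht]
      exact this
    have hf : ⁅b', k' ^ 2⁆ ^ 2 ^ i = 1 := by
      rw [commutatorElement_sq_right]
      apply conj_pow_eq_one
      rw [mul_pow_two_pow_eq (hHG b) (hHp b) (fun M _ => hHS b M) i (L := i + 1) (l := 2) (N := 0)
        (by omega) (by omega) (mem_powSeries_two_commutatorElement (hHG b) (hHp b) _ _)
        (Subtype.ext hpw), sq_pow_two_pow, hq]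
      rw [sq_pow_two_pow]
      exact pow_two_pow_eq_one_of_le hq (by omega)
    have hk4 : ((k' ^ 2) ^ 2) ^ 2 ^ (i + 1) = 1 := by
      rw [sq_pow_two_pow, sq_pow_two_pow]
      exact Subtype.ext hk1
    have hd := congrArg Subtype.val (mul_pow_two_pow_eq (hHG b) (hHp b) (fun M _ => hHS b M) i
      (L := i + 1) (l := 2) (N := 0) (by omega) (by omega)
      (mem_powSeries_two_commutatorElement (hHG b) (hHp b) _ _) hf hk4)
    rw [sq_pow_two_pow] at hd
    change (⁅b, k ^ 2⁆ * (k ^ 2) ^ 2) ^ 2 ^ i = (k ^ 2) ^ 2 ^ (i + 1) at hd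
    rw [hkh, hb2] at hd
    exact hd.symm

lemma commutatorOrderBound {G : Type*} [Group G] [Finite G] (hG : IsPGroup 2 G)
    (hp : IsPowerfulTwo G) : CommutatorOrderBound G :=
  commutatorOrderBound_of_card_eq _ G rfl hG hp

lemma commute_pow_four_of_pow_sixteen_eq_one {G : Type*} [Group G] [Finite G] (hG : IsPGroup 2 G)
    (hp : IsPowerfulTwo G) {a b : G} (ha : a ^ 2 ^ 4 = 1) (hb : b ^ 2 ^ 4 = 1) :
    Commute (b ^ 2 ^ 2) (a ^ 2 ^ 2) := by
  have hA := commutatorOrderBound hG hp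
  have hS := hA.commutatorPowBound hG hp
  set β := b ^ 2 ^ 2 with hβ
  have hβ2 : β ∈ powSeries G 2 := pow_two_pow_mem_powSeries b 2
  have hβ1 : β ^ 2 ^ 2 = 1 := by rw [hβ, ← pow_mul, ← pow_add, hb]
  have hh : ⁅β, a⁆ ^ 2 ^ 2 = 1 := hA 2 β a hβ1
  have hh4 : ⁅β, a⁆ ∈ powSeries G 4 := commutatorElement_mem_powSeries hG hp hβ2 a
  have hf : ⁅a, ⁅β, a⁆⁆ ^ 2 ^ 1 = 1 := by
    obtain ⟨s, hs⟩ := exists_pow_eq_of_mem_powSeries hG hp hh4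
    have := hS 5 s a (by rw [show 5 + 1 = 4 + 2 by rfl, pow_add, pow_mul, hs, hh])
      (pow_two_pow_eq_one_of_le ha (by omega)) 4 (by omega)
    rwa [hs] at this
  have hh1 : ⁅β, a ^ 2⁆ ^ 2 ^ 1 = 1 := by
    rw [commutatorElement_sq_right]
    apply conj_pow_eq_one
    rw [mul_pow_two_pow_eq hG hp (fun M _ => hS M) 1 (L := 4) (l := 4) (N := 0) (by omega)
      (by omega) (powSeries_antitone G (by omega)
        (commutatorElement_mem_powSeries' hG hp hh4 a)) hf, sq_pow_two_pow, hh]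
    rw [sq_pow_two_pow]
    exact pow_two_pow_eq_one_of_le hh (by omega)
  have hf1 : ⁅a ^ 2, ⁅β, a ^ 2⁆⁆ = 1 := by
    obtain ⟨s, hs⟩ := exists_pow_eq_of_mem_powSeries hG hp
      (commutatorElement_mem_powSeries hG hp hβ2 (a ^ 2))
    have := hS 4 s (a ^ 2) (by rw [show 4 + 1 = 2 + 2 + 1 by rfl, pow_add, pow_mul, hs, hh1])
      (by rw [sq_pow_two_pow]; exact pow_two_pow_eq_one_of_le ha (by omega)) 4 (by omega)
    rw [← hs]
    simpa using this
  rw [← commutatorElement_eq_one_iff_commute, show a ^ 2 ^ 2 = (a ^ 2) ^ 2 from pow_mul a 2 2,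
    commutatorElement_sq_right, hf1, one_mul, mul_inv_eq_one, mul_eq_left]
  simpa using hh1

/-- if G is a powerful 2-group and N ≤ G^4 is normal in G, then N/N^4
is abelian. Here N^4 is the subgroup of N generated by fourth powers of elements of N. -/
theorem stmt9 {G : Type*} [Group G] [Finite G] (hpG : IsPGroup 2 G)
    (hpowerful : ⁅(⊤ : Subgroup G), (⊤ : Subgroup G)⁆ ≤ sgPow ⊤ 4)
    (N : Subgroup G) (hN : N.Normal) (hNle : N ≤ sgPow ⊤ 4) :
    ∀ a b : (↥N ⧸ sgPow (⊤ : Subgroup ↥N) 4), a * b = b * a := by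
  have hp : IsPowerfulTwo G := hpowerful
  have hroot : ∀ a : N, ∃ s : G, s ^ 2 ^ 2 = a := fun a =>
    exists_pow_eq_of_mem_powSeries (i := 2) hpG hp (sgPow_four_le ⊤ (hNle a.2))
  have hM := sgPow_normal N 4
  have hquot : ∀ (a : N) (s : G), s ^ 2 ^ 2 = a →
      (QuotientGroup.mk' (sgPow N 4) s) ^ 2 ^ 4 = 1 := fun a s hs => by
    rw [← map_pow, show (2 ^ 4 : ℕ) = 2 ^ 2 * 4 by rfl, pow_mul, hs]
    exact (QuotientGroup.eq_one_iff _).2 (pow_mem_sgPow a.2 4)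
  intro a b
  induction a using QuotientGroup.induction_on with | H a =>
  induction b using QuotientGroup.induction_on with | H b =>
  obtain ⟨s, hs⟩ := hroot a
  obtain ⟨t, ht⟩ := hroot b
  have h := commute_pow_four_of_pow_sixteen_eq_one (hpG.to_quotient (sgPow N 4)) (hp.quotient _)
    (hquot b t ht) (hquot a s hs)
  rw [← map_pow, ← map_pow, hs, ht, ← commutatorElement_eq_one_iff_commute,
    ← map_commutatorElement] at h
  obtain ⟨c, hc, hc'⟩ := mem_sgPow_iff_exists_mem_top.1 ((QuotientGroup.eq_one_iff _).1 h)
  have hcab : c = ⁅a, b⁆ := Subtype.ext hc'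
  rw [← commutatorElement_eq_one_iff_mul_comm]
  rw [hcab] at hc
  exact (QuotientGroup.eq_one_iff _).2 hc
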